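/- Let A be an abelian group, φ a quasi-endomorphism of A, and B ≤ A a subgroup that is almost φ-invariant, i.e. φ[B] ∩ B has finite index in φ[B], where φ[B] := {b ∈ A : ∃ a ∈ B, (a,b) ∈ φ}. Then the restriction-corestriction φ_B := φ ∩ (B × B) is a quasi-endomorphism of B: its domain has finite index in B and its katakernel kat(φ) ∩ B is finite. -/

import Mathlib

open Pointwise

variable {A : Type*} [AddCommGroup A]

/-- `φ` is (the underlying set of) an additive subgroup of `A × A`. -/
def IsSubgroupRel (φ : Set (A × A)) : Prop :=
  (0 : A × A) ∈ φ ∧ (∀ x ∈ φ, ∀ y ∈ φ, x + y ∈ φ) ∧ ∀ x ∈ φ, -x ∈ φ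

/-- The katakernel `kat φ = {b : (0, b) ∈ φ}`. -/
def kat (φ : Set (A × A)) : Set A := {b | ((0 : A), b) ∈ φ}

/-- The image `φ[S] = {b : ∃ a ∈ S, (a, b) ∈ φ}`. -/
def img (φ : Set (A × A)) (S : Set A) : Set A := {b | ∃ a ∈ S, (a, b) ∈ φ}

/-- An endogeny of `A`: a total additive subgroup of `A × A` with finite katakernel. -/
def IsEndogeny (φ : Set (A × A)) : Prop :=
  IsSubgroupRel φ ∧ (∀ a : A, ∃ b, (a, b) ∈ φ) ∧ (kat φ).Finite

/-- The sum `φ + ψ` of two endogenies. -/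
def esum (φ ψ : Set (A × A)) : Set (A × A) :=
  {p | ∃ b₁ b₂, (p.1, b₁) ∈ φ ∧ (p.1, b₂) ∈ ψ ∧ p.2 = b₁ + b₂}

/-- The composition `φ ∘ ψ` of two endogenies. -/
def ecomp (φ ψ : Set (A × A)) : Set (A × A) :=
  {p | ∃ b, (p.1, b) ∈ ψ ∧ (b, p.2) ∈ φ}

/-- The negation `-φ` of an endogeny. -/
def eneg (φ : Set (A × A)) : Set (A × A) := {p | (p.1, -p.2) ∈ φ}

/-- The domain `Dom φ = {a : ∃ b, (a, b) ∈ φ}`. -/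
def Dom (φ : Set (A × A)) : Set A := {a | ∃ b, (a, b) ∈ φ}

/-- A quasi-endomorphism of `A`: an additive subgroup of `A × A` whose domain has
finite index in `A` and whose katakernel is finite. -/
def IsQuasiEndo (φ : Set (A × A)) : Prop :=
  IsSubgroupRel φ ∧ (∃ F : Set A, F.Finite ∧ Set.univ ⊆ Dom φ + F) ∧ (kat φ).Finite

/-- If a colouring of an additive group with finitely many colours is such that the difference of
any two elements of the same colour lies in `D`, then finitely many translates of `D` cover
the group. -/
theorem exists_finite_univ_subset_add {G K : Type*} [AddCommGroup G] {D : Set G} (c : G → K)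
    (hc : (Set.range c).Finite) (h : ∀ x y, c x = c y → x - y ∈ D) :
    ∃ F : Set G, F.Finite ∧ Set.univ ⊆ D + F := by
  choose r hr using fun k : Set.range c => k.2
  have : Finite (Set.range c) := hc
  refine ⟨Set.range r, Set.finite_range r, fun x _ => ?_⟩
  exact ⟨x - r ⟨c x, x, rfl⟩, h _ _ (hr ⟨c x, x, rfl⟩).symm, _, ⟨_, rfl⟩, sub_add_cancel _ _⟩

/-- The difference of two elements of an additive subgroup of `A × A` lies in it. -/
theorem IsSubgroupRel.sub_mem {φ : Set (A × A)} (hφ : IsSubgroupRel φ) {a b a' b' : A}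
    (h : (a, b) ∈ φ) (h' : (a', b') ∈ φ) : (a - a', b - b') ∈ φ := by
  simpa [sub_eq_add_neg] using hφ.2.1 _ h _ (hφ.2.2 _ h')

/-- If finitely many translates of `Dom φ` cover `A`, then finitely many translates of
`Dom φ ∩ B` by elements of `B` cover `B`. -/
theorem IsSubgroupRel.exists_finite_cover_dom {φ : Set (A × A)} (hφ : IsSubgroupRel φ)
    (hD : ∃ F : Set A, F.Finite ∧ Set.univ ⊆ Dom φ + F) (B : AddSubgroup A) :
    ∃ F : Set B, F.Finite ∧ Set.univ ⊆ {b : B | (b : A) ∈ Dom φ} + F := by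
  obtain ⟨F, hF, hcover⟩ := hD
  choose d hd f hf hdf using fun a : A => hcover (Set.mem_univ a)
  refine exists_finite_univ_subset_add (fun b : B => f b)
    (hF.subset (Set.range_subset_iff.2 fun b => hf b)) fun x y hxy => ?_
  obtain ⟨u, hu⟩ := hd x
  obtain ⟨v, hv⟩ := hd y
  refine ⟨u - v, ?_⟩
  have hxy' : f (x : A) = f (y : A) := hxy
  have key : ((x - y : B) : A) = d x - d y := by
    have hx : d (x : A) + f x = x := hdf x
    have hy : d (y : A) + f y = y := hdf y
    rw [AddSubgroup.coe_sub]
    nth_rewrite 1 [← hx, ← hy]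
    rw [hxy', add_sub_add_right_eq_sub]
  rw [key]
  exact hφ.sub_mem hu hv

theorem quasiEndo_restriction (φ : Set (A × A)) (hφ : IsQuasiEndo φ) (B : AddSubgroup A)
    (hB : ∃ F : Set A, F.Finite ∧
      img φ (B : Set A) ⊆ (img φ (B : Set A) ∩ (B : Set A)) + F) :
    IsQuasiEndo {p : B × B | ((p.1 : A), (p.2 : A)) ∈ φ} ∧
      Subtype.val '' kat {p : B × B | ((p.1 : A), (p.2 : A)) ∈ φ} = kat φ ∩ (B : Set A) := by
  obtain ⟨hsub, hdom, hkat⟩ := hφ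
  refine ⟨⟨⟨hsub.1, fun x hx y hy => hsub.2.1 _ hx _ hy, fun x hx => hsub.2.2 _ hx⟩, ?_, ?_⟩, ?_⟩
  · obtain ⟨F, hF, hcover⟩ := hsub.exists_finite_cover_dom hdom B
    obtain ⟨E, hE, hcoverE⟩ := hB
    choose d hd f hf hdf using fun b : B => hcover (Set.mem_univ b)
    choose y hy using hd
    choose z hz g hg hzg using fun b : B => hcoverE ⟨(d b : A), (d b).2, hy b⟩
    refine exists_finite_univ_subset_add (fun b : B => (f b, g b)) ((hF.prod hE).subset
      (Set.range_subset_iff.2 fun b => ⟨hf b, hg b⟩)) fun b b' h => ?_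
    obtain ⟨h₁, h₂⟩ := Prod.mk.inj h
    have hdd : b - b' = d b - d b' := by
      have hb : d b + f b = b := hdf b
      have hb' : d b' + f b' = b' := hdf b'
      nth_rewrite 1 [← hb, ← hb']
      rw [h₁, add_sub_add_right_eq_sub]
    have hyy : y b - y b' = z b - z b' := by
      have hb : z b + g b = y b := hzg b
      have hb' : z b' + g b' = y b' := hzg b'
      rw [← hb, ← hb', h₂, add_sub_add_right_eq_sub]
    refine ⟨⟨z b - z b', B.sub_mem (hz b).2 (hz b').2⟩, ?_⟩
    change (((b - b' : B) : A), z b - z b') ∈ φ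
    rw [hdd, ← hyy]
    exact hsub.sub_mem (hy b) (hy b')
  · have := hkat.preimage (f := ((↑) : B → A)) Subtype.val_injective.injOn
    exact this
  · ext a
    constructor
    · rintro ⟨b, hb, rfl⟩
      exact ⟨hb, b.2⟩
    · rintro ⟨ha, haB⟩
      exact ⟨⟨a, haB⟩, ha, rfl⟩
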